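/- arXiv:1102.0805 — 2 statements merged into one kernel-verified Lean document; each statement's English description precedes it below -/
import Mathlib

section
/- Let G be a finite simple graph, k a positive integer, and w a fractional k-colouring of G. Let (X_1, Y_1), …, (X_m, Y_m) be pairs of cliques of G such that the sets X_1, …, X_m are nonempty and pairwise disjoint, there is no edge of G between X_i and X_j for i ≠ j, and Y_i ∩ X_j = ∅ for all i and j. For each i, let w_i denote the total weight under w of the stable sets intersecting both X_i and Y_i. Then G has a fractional (k+1)-colouring w' such that for every i, the total weight under w' of the stable sets intersecting both X_i and Y_i equals ⌊w_i⌋. -/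
/-- A fractional `c`-colouring of `G`: a nonnegative real weight on each finset of
vertices, supported on stable (independent) sets, with total weight at most `c`,
such that for each vertex the total weight of sets containing it is exactly 1. -/
def IsFractionalColoring {V : Type*} [Fintype V] [DecidableEq V]
    (G : SimpleGraph V) (w : Finset V → ℝ) (c : ℝ) : Prop :=
  (∀ S : Finset V, 0 ≤ w S) ∧
  (∀ S : Finset V, w S ≠ 0 → ∀ u ∈ S, ∀ v ∈ S, ¬ G.Adj u v) ∧
  (∑ S : Finset V, w S ≤ c) ∧
  (∀ v : V, ∑ S ∈ Finset.univ.filter (fun S : Finset V => v ∈ S), w S = 1)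

/-- The overlap of cliques `X` and `Y` under the weighting `w`: the total weight of
the sets intersecting both `X` and `Y`. -/
noncomputable def overlap {V : Type*} [Fintype V] [DecidableEq V]
    (w : Finset V → ℝ) (X Y : Finset V) : ℝ :=
  ∑ S ∈ Finset.univ.filter
      (fun S : Finset V => (S ∩ X).Nonempty ∧ (S ∩ Y).Nonempty), w S

/-- hitting indicator -/
noncomputable def hitInd {V : Type*} [DecidableEq V] (X Y S : Finset V) : ℝ :=
  if (S ∩ X).Nonempty ∧ (S ∩ Y).Nonempty then 1 else 0

theorem overlap_eq_hit {V : Type*} [Fintype V] [DecidableEq V]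
    (w : Finset V → ℝ) (X Y : Finset V) :
    overlap w X Y = ∑ S, w S * hitInd X Y S := by
  simp [overlap, hitInd, Finset.sum_filter]

theorem hitInd_nonneg {V : Type*} [DecidableEq V] (X Y S : Finset V) : 0 ≤ hitInd X Y S := by
  unfold hitInd; split_ifs <;> norm_num

theorem hitInd_le_one {V : Type*} [DecidableEq V] (X Y S : Finset V) : hitInd X Y S ≤ 1 := by
  unfold hitInd; split_ifs <;> norm_num

theorem sum_push {ι A : Type*} [Fintype ι] [Fintype A] [DecidableEq A]
    (a : ι → ℝ) (s : ι → A) (φ : A → ℝ) :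
    ∑ S, (∑ i, if s i = S then a i else 0) * φ S = ∑ i, a i * φ (s i) := by
  simp_rw [Finset.sum_mul]
  rw [Finset.sum_comm]
  simp

/-- the invariant -/
structure OverlapInv {V : Type*} [Fintype V] [DecidableEq V] (G : SimpleGraph V) (w : Finset V → ℝ)
    {m : ℕ} (X Y : Fin m → Finset V) (I : Finset (Fin m)) (v u : Finset V → ℝ) : Prop where
  v0 : ∀ S, 0 ≤ v S
  u0 : ∀ S, 0 ≤ u S
  vs : ∀ S : Finset V, v S ≠ 0 → ∀ a ∈ S, ∀ b ∈ S, ¬ G.Adj a b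
  us : ∀ S : Finset V, u S ≠ 0 → ∀ a ∈ S, ∀ b ∈ S, ¬ G.Adj a b
  vt : ∑ S, v S = ∑ S, w S
  ut : ∑ S, u S = 1
  cov : ∀ x, ∑ S, v S * (if x ∈ S then 1 else 0) + ∑ S, u S * (if x ∈ S then 1 else 0) = 1
  usub : ∀ S : Finset V, u S ≠ 0 → ∀ a ∈ S, ∃ i ∈ I, a ∈ X i
  ovI : ∀ i ∈ I, overlap v (X i) (Y i) = (⌊overlap w (X i) (Y i)⌋ : ℝ)
  ovN : ∀ i ∉ I, overlap v (X i) (Y i) = overlap w (X i) (Y i)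

theorem inv_step {V : Type*} [Fintype V] [DecidableEq V] (G : SimpleGraph V) (w : Finset V → ℝ)
    {m : ℕ} (X Y : Fin m → Finset V)
    (hXdisj : ∀ i j, i ≠ j → Disjoint (X i) (X j))
    (hXnoedge : ∀ i j, i ≠ j → ∀ u ∈ X i, ∀ v ∈ X j, ¬ G.Adj u v)
    (hYX : ∀ i j, Y i ∩ X j = ∅)
    (I : Finset (Fin m)) (i : Fin m) (hi : i ∉ I) (v u : Finset V → ℝ)
    (H : OverlapInv G w X Y I v u) : ∃ v' u', OverlapInv G w X Y (insert i I) v' u' := by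
  obtain ⟨v0, u0, vs, us, vt, ut, cov, usub, ovI, ovN⟩ := H
  have hov := ovN i hi
  set o := overlap w (X i) (Y i) with ho
  have o0 : 0 ≤ o := by
    rw [← hov, overlap_eq_hit]
    exact Finset.sum_nonneg fun S _ => mul_nonneg (v0 S) (hitInd_nonneg _ _ _)
  obtain ⟨t, t0, t1, hto⟩ : ∃ t : ℝ, 0 ≤ t ∧ t ≤ 1 ∧ t * o = Int.fract o := by
    rcases eq_or_lt_of_le o0 with h | h
    · exact ⟨0, le_rfl, zero_le_one, by simp [← h]⟩
    · refine ⟨Int.fract o / o, div_nonneg (Int.fract_nonneg _) o0, ?_, by field_simp⟩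
      rw [div_le_one h]
      have : (0 : ℤ) ≤ ⌊o⌋ := Int.floor_nonneg.2 o0
      have h2 : (0 : ℝ) ≤ ⌊o⌋ := by exact_mod_cast this
      have := Int.floor_add_fract o
      linarith
  set f := Int.fract o with hf
  have f1 : f ≤ 1 := (Int.fract_lt_one o).le
  set h : Finset V → ℝ := hitInd (X i) (Y i) with hh
  have h0 : ∀ S, 0 ≤ h S := hitInd_nonneg _ _
  have h1 : ∀ S, h S ≤ 1 := hitInd_le_one _ _
  have hsum : ∑ R, t * h R * v R = f := by
    rw [← hto, ← hov, overlap_eq_hit, Finset.mul_sum]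
    exact Finset.sum_congr rfl fun R _ => by ring
  let v' : Finset V → ℝ := fun S => (1 - t * h S) * v S +
    ∑ R : Finset V, if R \ X i = S then t * h R * v R else 0
  let u' : Finset V → ℝ := fun S => (1 - f) * u S +
    ∑ p : Finset V × Finset V,
      if p.1 ∪ (p.2 ∩ X i) = S then u p.1 * (t * h p.2 * v p.2) else 0
  have Ev : ∀ φ : Finset V → ℝ, ∑ S, v' S * φ S =
      ∑ S, v S * φ S + ∑ R, t * h R * v R * (φ (R \ X i) - φ R) := by
    intro φ
    simp only [v', add_mul, Finset.sum_add_distrib]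
    rw [sum_push (fun R => t * h R * v R) (fun R => R \ X i) φ, ← Finset.sum_add_distrib,
      ← Finset.sum_add_distrib]
    exact Finset.sum_congr rfl fun R _ => by ring
  have Eu : ∀ φ : Finset V → ℝ, ∑ S, u' S * φ S =
      (1 - f) * ∑ S, u S * φ S +
        ∑ T, ∑ R, u T * (t * h R * v R) * φ (T ∪ (R ∩ X i)) := by
    intro φ
    simp only [u', add_mul, Finset.sum_add_distrib]
    rw [sum_push (fun p : Finset V × Finset V => u p.1 * (t * h p.2 * v p.2))
      (fun p => p.1 ∪ (p.2 ∩ X i)) φ, Fintype.sum_prod_type, Finset.mul_sum]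
    congr 1
    exact Finset.sum_congr rfl fun R _ => by ring
  have th1 : ∀ S, 0 ≤ 1 - t * h S := fun S => by nlinarith [h0 S, h1 S]
  have g0 : ∀ R, 0 ≤ t * h R * v R := fun R => mul_nonneg (mul_nonneg t0 (h0 R)) (v0 R)
  have ovE : ∀ j, overlap v' (X j) (Y j) = overlap v (X j) (Y j) +
      ∑ R, t * h R * v R * (hitInd (X j) (Y j) (R \ X i) - hitInd (X j) (Y j) R) := by
    intro j
    rw [overlap_eq_hit, overlap_eq_hit, Ev]
  have ovne : ∀ j, j ≠ i → overlap v' (X j) (Y j) = overlap v (X j) (Y j) := by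
    intro j hj
    rw [ovE, Finset.sum_eq_zero, add_zero]
    intro R _
    have e1 : (R \ X i) ∩ X j = R ∩ X j := by
      ext a
      have : a ∈ X j → a ∉ X i := fun q => Finset.disjoint_left.1 (hXdisj j i hj) q
      simp; tauto
    have e2 : (R \ X i) ∩ Y j = R ∩ Y j := by
      ext a
      have : a ∉ Y j ∩ X i := by simp [hYX]
      simp at this ⊢; tauto
    simp [hitInd, e1, e2]
  have u'ne : ∀ S, u' S ≠ 0 → u S ≠ 0 ∨ ∃ T R : Finset V, T ∪ (R ∩ X i) = S ∧ u T ≠ 0 ∧ v R ≠ 0 := by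
    intro S hS
    by_contra hc
    push Not at hc
    apply hS
    simp only [u', hc.1, mul_zero, zero_add]
    apply Finset.sum_eq_zero
    rintro ⟨T, R⟩ _
    split_ifs with hTR
    · by_cases hT : u T = 0
      · simp [hT]
      · simp [hc.2 T R hTR hT]
    · rfl
  refine ⟨v', u', ?_, ?_, ?_, ?_, ?_, ?_, ?_, ?_, ?_, ?_⟩
  · intro S
    refine add_nonneg (mul_nonneg (th1 S) (v0 S)) (Finset.sum_nonneg fun R _ => ?_)
    split_ifs
    · exact g0 R
    · exact le_rfl
  · intro S
    refine add_nonneg (mul_nonneg (by linarith) (u0 S)) (Finset.sum_nonneg fun R _ => ?_)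
    split_ifs
    · exact mul_nonneg (u0 _) (g0 _)
    · exact le_rfl
  · intro S hS a ha b hb
    by_cases hv : v S = 0
    · obtain ⟨R, -, hR⟩ : ∃ R ∈ Finset.univ, (if R \ X i = S then t * h R * v R else 0) ≠ 0 := by
        apply Finset.exists_ne_zero_of_sum_ne_zero
        simpa [v', hv] using hS
      split_ifs at hR with hRS
      · subst hRS
        exact vs R (right_ne_zero_of_mul hR) a (Finset.mem_sdiff.1 ha).1 b (Finset.mem_sdiff.1 hb).1
      · exact absurd rfl hR
    · exact vs S hv a ha b hb
  · intro S hS a ha b hb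
    rcases u'ne S hS with hu | ⟨T, R, rfl, hT, hR⟩
    · exact us S hu a ha b hb
    · have key : ∀ a ∈ T, ∀ b ∈ X i, ¬ G.Adj a b := by
        intro a ha b hb
        obtain ⟨j, hj, haj⟩ := usub T hT a ha
        exact hXnoedge j i (fun e => hi (e ▸ hj)) a haj b hb
      simp only [Finset.mem_union, Finset.mem_inter] at ha hb
      rcases ha with ha | ha <;> rcases hb with hb | hb
      · exact us T hT a ha b hb
      · exact key a ha b hb.2
      · exact fun e => key b hb a ha.2 e.symm
      · exact vs R hR a ha.1 b hb.1
  · have := Ev (fun _ => 1)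
    simp only [mul_one, sub_self, mul_zero, Finset.sum_const_zero, add_zero] at this
    rw [this, vt]
  · have := Eu (fun _ => 1)
    simp only [mul_one] at this
    rw [this, ut]
    simp_rw [← Finset.mul_sum, hsum]
    rw [← Finset.sum_mul, ut]; ring
  · intro x
    rw [Ev, Eu]
    by_cases hx : x ∈ X i
    · have hT : ∀ T, u T ≠ 0 → x ∉ T := by
        intro T hT hxT
        obtain ⟨j, hj, hxj⟩ := usub T hT x hxT
        exact Finset.disjoint_left.1 (hXdisj j i (fun e => hi (e ▸ hj))) hxj hx
      have z : ∑ S, u S * (if x ∈ S then (1:ℝ) else 0) = 0 := by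
        apply Finset.sum_eq_zero
        intro T _
        by_cases hu : u T = 0
        · simp [hu]
        · simp [hT T hu]
      have c := cov x
      rw [z] at c ⊢
      have e2 : ∑ T, ∑ R, u T * (t * h R * v R) * (if x ∈ T ∪ (R ∩ X i) then (1:ℝ) else 0)
          = ∑ R, t * h R * v R * (if x ∈ R then 1 else 0) := by
        have : ∑ R, t * h R * v R * (if x ∈ R then (1:ℝ) else 0) =
            ∑ T, u T * ∑ R, t * h R * v R * (if x ∈ R then (1:ℝ) else 0) := by
          rw [← Finset.sum_mul, ut, one_mul]
        rw [this]
        refine Finset.sum_congr rfl fun T _ => ?_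
        rw [Finset.mul_sum]
        refine Finset.sum_congr rfl fun R _ => ?_
        by_cases hu : u T = 0
        · simp [hu]
        · simp [hT T hu, hx]
      have e1 : ∑ R, t * h R * v R * ((if x ∈ R \ X i then (1:ℝ) else 0) - if x ∈ R then 1 else 0)
          = - ∑ R, t * h R * v R * (if x ∈ R then 1 else 0) := by
        rw [← Finset.sum_neg_distrib]
        refine Finset.sum_congr rfl fun R _ => ?_
        simp [hx]
      rw [e1, e2]; linarith
    · simp only [Finset.mem_sdiff, hx, Finset.mem_union, Finset.mem_inter, and_false, or_false,
        not_false_eq_true, and_true, sub_self, mul_zero, Finset.sum_const_zero, add_zero]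
      simp_rw [← Finset.sum_mul, ← Finset.mul_sum, hsum]
      have : ∑ T, u T * f * (if x ∈ T then (1:ℝ) else 0)
          = f * ∑ T, u T * (if x ∈ T then (1:ℝ) else 0) := by
        rw [Finset.mul_sum]
        exact Finset.sum_congr rfl fun R _ => by ring
      rw [this]; linear_combination cov x
  · intro S hS a ha
    rcases u'ne S hS with hu | ⟨T, R, rfl, hT, hR⟩
    · obtain ⟨j, hj, h⟩ := usub S hu a ha
      exact ⟨j, Finset.mem_insert_of_mem hj, h⟩
    · rcases Finset.mem_union.1 ha with ha | ha
      · obtain ⟨j, hj, h⟩ := usub T hT a ha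
        exact ⟨j, Finset.mem_insert_of_mem hj, h⟩
      · exact ⟨i, Finset.mem_insert_self _ _, (Finset.mem_inter.1 ha).2⟩
  · intro j hj
    by_cases hji : j = i
    · subst hji
      rw [ovE, hov]
      have : ∑ R, t * h R * v R * (hitInd (X j) (Y j) (R \ X j) - hitInd (X j) (Y j) R) = - f := by
        rw [← hsum, ← Finset.sum_neg_distrib]
        refine Finset.sum_congr rfl fun R _ => ?_
        have e : (R \ X j) ∩ X j = ∅ := by ext; simp
        have e1 : hitInd (X j) (Y j) (R \ X j) = 0 := by simp [hitInd, e]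
        have e2 : h R * hitInd (X j) (Y j) R = h R := by
          rw [hh]; unfold hitInd; split_ifs <;> norm_num
        rw [e1]; linear_combination (- t * v R) * e2
      rw [this]
      have := Int.floor_add_fract o
      linarith
    · rw [ovne j hji]
      exact ovI j ((Finset.mem_insert.1 hj).resolve_left hji)
  · intro j hj
    rw [Finset.mem_insert, not_or] at hj
    rw [ovne j hj.1, ovN j hj.2]

/-- Given a fractional `k`-colouring `w` of `G` and pairs of cliques `(X i, Y i)` with
the `X i` nonempty, pairwise disjoint and pairwise non-adjacent, and `Y i ∩ X j = ∅`
for all `i, j`, there is a fractional `(k+1)`-colouring whose overlap on each pair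
`(X i, Y i)` is the floor of the overlap of `w` on that pair. -/
theorem exists_fractional_coloring_with_integral_overlaps
    {V : Type*} [Fintype V] [DecidableEq V] (G : SimpleGraph V)
    (k : ℕ) (hk : 0 < k) (w : Finset V → ℝ)
    (hw : IsFractionalColoring G w (k : ℝ))
    (m : ℕ) (X Y : Fin m → Finset V)
    (hXclique : ∀ i, G.IsClique (X i : Set V))
    (hYclique : ∀ i, G.IsClique (Y i : Set V))
    (hXnonempty : ∀ i, (X i).Nonempty)
    (hXdisj : ∀ i j, i ≠ j → Disjoint (X i) (X j))
    (hXnoedge : ∀ i j, i ≠ j → ∀ u ∈ X i, ∀ v ∈ X j, ¬ G.Adj u v)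
    (hYX : ∀ i j, Y i ∩ X j = ∅) :
    ∃ w' : Finset V → ℝ, IsFractionalColoring G w' ((k : ℝ) + 1) ∧
      ∀ i, overlap w' (X i) (Y i) = (⌊overlap w (X i) (Y i)⌋ : ℝ) := by
  obtain ⟨w0, ws, wt, wc⟩ := hw
  have main : ∀ I : Finset (Fin m), ∃ v u, OverlapInv G w X Y I v u := by
    intro I
    induction I using Finset.induction_on with
    | empty =>
      refine ⟨w, fun S => if S = ∅ then 1 else 0, w0, ?_, ws, ?_, rfl, ?_, ?_, ?_, ?_, ?_⟩
      · intro S; split_ifs <;> norm_num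
      · intro S hS a ha
        have : S = ∅ := by simpa using hS
        simp [this] at ha
      · simp
      · intro x
        have := wc x
        rw [Finset.sum_filter] at this
        have z : ∑ S : Finset V, (if S = ∅ then (1:ℝ) else 0) * (if x ∈ S then 1 else 0) = 0 := by
          apply Finset.sum_eq_zero
          intro S _
          by_cases hS : S = ∅ <;> simp [hS]
        rw [z]
        simp [this]
      · intro S hS a ha
        have : S = ∅ := by simpa using hS
        simp [this] at ha
      · simp
      · intro i _; rfl
    | insert i I hi ih =>
      obtain ⟨v, u, H⟩ := ih
      exact inv_step G w X Y hXdisj hXnoedge hYX I i hi v u H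
  obtain ⟨v, u, H⟩ := main Finset.univ
  refine ⟨fun S => v S + u S, ⟨fun S => add_nonneg (H.v0 S) (H.u0 S), ?_, ?_, ?_⟩, ?_⟩
  · intro S hS
    by_cases hv : v S = 0
    · exact H.us S (by simpa [hv] using hS)
    · exact H.vs S hv
  · rw [Finset.sum_add_distrib, H.vt, H.ut]; linarith
  · intro x
    rw [Finset.sum_filter, ← H.cov x, ← Finset.sum_add_distrib]
    refine Finset.sum_congr rfl fun S _ => ?_
    split_ifs <;> simp
  · intro i
    rw [← H.ovI i (Finset.mem_univ i), overlap_eq_hit, overlap_eq_hit]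
    refine Finset.sum_congr rfl fun S _ => ?_
    by_cases hu : u S = 0
    · simp [hu]
    · have : S ∩ Y i = ∅ := by
        ext a
        simp only [Finset.mem_inter, Finset.notMem_empty, iff_false, not_and]
        intro ha hY
        obtain ⟨j, _, hj⟩ := H.usub S hu a ha
        have : a ∈ Y i ∩ X j := Finset.mem_inter.2 ⟨hY, hj⟩
        simp [hYX] at this
      simp [hitInd, this]
end

section
/- Let G be a finite quasi-line graph on vertex set V containing a nonlinear homogeneous pair of cliques. Then there exists a quasi-line graph G' on the same vertex set V whose edge set is a proper subset of the edge set of G and which satisfies χ(G') = χ(G). -/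
/-- `G` is quasi-line: the neighbourhood of every vertex is covered by two cliques. -/
def IsQuasiLine {V : Type*} (G : SimpleGraph V) : Prop :=
  ∀ v : V, ∃ K₁ K₂ : Set V, G.IsClique K₁ ∧ G.IsClique K₂ ∧
    G.neighborSet v ⊆ K₁ ∪ K₂

/-- `(A, B)` is a homogeneous pair of cliques in `G`: `A` and `B` are disjoint nonempty
cliques with `|A ∪ B| ≥ 3`, and every vertex outside `A ∪ B` sees all or none of `A`
and all or none of `B`. -/
def IsHomogeneousPairOfCliques {V : Type*} (G : SimpleGraph V) (A B : Set V) : Prop :=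
  Disjoint A B ∧ A.Nonempty ∧ B.Nonempty ∧
  G.IsClique A ∧ G.IsClique B ∧ 3 ≤ (A ∪ B).ncard ∧
  (∀ v ∉ A ∪ B,
    ((∀ a ∈ A, G.Adj v a) ∨ (∀ a ∈ A, ¬ G.Adj v a)) ∧
    ((∀ b ∈ B, G.Adj v b) ∨ (∀ b ∈ B, ¬ G.Adj v b)))

/-- A homogeneous pair of cliques `(A, B)` is nonlinear if `G[A ∪ B]` contains an
induced 4-cycle. -/
def IsNonlinearHomogeneousPairOfCliques {V : Type*} (G : SimpleGraph V)
    (A B : Set V) : Prop :=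
  IsHomogeneousPairOfCliques G A B ∧
  (∃ v₁ v₂ v₃ v₄ : V, v₁ ∈ A ∪ B ∧ v₂ ∈ A ∪ B ∧ v₃ ∈ A ∪ B ∧ v₄ ∈ A ∪ B ∧
    v₁ ≠ v₂ ∧ v₁ ≠ v₃ ∧ v₁ ≠ v₄ ∧ v₂ ≠ v₃ ∧ v₂ ≠ v₄ ∧ v₃ ≠ v₄ ∧
    G.Adj v₁ v₂ ∧ G.Adj v₂ v₃ ∧ G.Adj v₃ v₄ ∧ G.Adj v₄ v₁ ∧
    ¬ G.Adj v₁ v₃ ∧ ¬ G.Adj v₂ v₄)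

/-- Keep from the `A`-`B` edges only those between `P` and `Q`. -/
def redGraph {V : Type*} (G : SimpleGraph V) (A B P Q : Finset V) : SimpleGraph V where
  Adj u v := G.Adj u v ∧ (u ∈ A → v ∈ B → u ∈ P ∧ v ∈ Q) ∧ (v ∈ A → u ∈ B → v ∈ P ∧ u ∈ Q)
  symm := ⟨fun _ _ h => ⟨h.1.symm, h.2.2, h.2.1⟩⟩
  loopless := ⟨fun _ h => G.loopless.irrefl _ h.1⟩

lemma redGraph_swap {V : Type*} (G : SimpleGraph V) (A B P Q : Finset V) :
    redGraph G A B P Q = redGraph G B A Q P := by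
  ext u v
  simp only [redGraph]
  tauto

lemma red_key {V : Type*} (G : SimpleGraph V) (A B P Q : Finset V)
    (hd : Disjoint A B) (hA : G.IsClique (A : Set V)) (hB : G.IsClique (B : Set V))
    (hhA : ∀ v, v ∉ A → v ∉ B → (∀ a ∈ A, G.Adj v a) ∨ (∀ a ∈ A, ¬ G.Adj v a))
    (hhB : ∀ v, v ∉ A → v ∉ B → (∀ a ∈ B, G.Adj v a) ∨ (∀ a ∈ B, ¬ G.Adj v a))
    (v : V) (K₁ K₂ : Set V) (h1 : G.IsClique K₁) (h2 : G.IsClique K₂)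
    (h3 : G.neighborSet v ⊆ K₁ ∪ K₂) (a : V) (ha : a ∈ A) (b : V) (hb : b ∈ B)
    (haK : a ∈ K₁) (hbK : b ∈ K₂) :
    ∃ K₁ K₂ : Set V, (redGraph G A B P Q).IsClique K₁ ∧ (redGraph G A B P Q).IsClique K₂ ∧
    (redGraph G A B P Q).neighborSet v ⊆ K₁ ∪ K₂ := by
  have hd' : ∀ x, x ∈ A → x ∉ B := fun x h h' => (Finset.disjoint_left.mp hd) h h'
  have e1 : ∀ w ∈ K₁, w ∉ A → w ∉ B → ∀ a ∈ A, G.Adj w a := by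
    intro w hw hwA hwB
    have := h1 hw haK (by rintro rfl; exact hwA ha)
    rcases hhA w hwA hwB with h | h
    · exact h
    · exact absurd this (h a ha)
  have e2 : ∀ w ∈ K₂, w ∉ A → w ∉ B → ∀ a ∈ B, G.Adj w a := by
    intro w hw hwA hwB
    have := h2 hw hbK (by rintro rfl; exact hwB hb)
    rcases hhB w hwA hwB with h | h
    · exact h
    · exact absurd this (h b hb)
  refine ⟨{x | x ∈ A ∨ (x ∈ K₁ ∧ x ∉ A ∧ x ∉ B)}, {x | x ∈ B ∨ (x ∈ K₂ ∧ x ∉ A ∧ x ∉ B)}, ?_, ?_, ?_⟩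
  · intro x hx y hy hxy
    have hadj : G.Adj x y := by
      rcases hx with hx | hx <;> rcases hy with hy | hy
      · exact hA hx hy hxy
      · exact (e1 y hy.1 hy.2.1 hy.2.2 x hx).symm
      · exact e1 x hx.1 hx.2.1 hx.2.2 y hy
      · exact h1 hx.1 hy.1 hxy
    refine ⟨hadj, ?_, ?_⟩ <;> grind
  · intro x hx y hy hxy
    have hadj : G.Adj x y := by
      rcases hx with hx | hx <;> rcases hy with hy | hy
      · exact hB hx hy hxy
      · exact (e2 y hy.1 hy.2.1 hy.2.2 x hx).symm
      · exact e2 x hx.1 hx.2.1 hx.2.2 y hy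
      · exact h2 hx.1 hy.1 hxy
    refine ⟨hadj, ?_, ?_⟩ <;> grind
  · intro x hx
    have := h3 (show x ∈ G.neighborSet v from hx.1)
    by_cases hxA : x ∈ A
    · exact Or.inl (Or.inl hxA)
    by_cases hxB : x ∈ B
    · exact Or.inr (Or.inl hxB)
    rcases this with h | h
    · exact Or.inl (Or.inr ⟨h, hxA, hxB⟩)
    · exact Or.inr (Or.inr ⟨h, hxA, hxB⟩)

lemma red_key2 {V : Type*} (G : SimpleGraph V) (hG : IsQuasiLine G) (A B P Q : Finset V)
    (hd : Disjoint A B) (hA : G.IsClique (A : Set V)) (hB : G.IsClique (B : Set V))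
    (hhA : ∀ v, v ∉ A → v ∉ B → (∀ a ∈ A, G.Adj v a) ∨ (∀ a ∈ A, ¬ G.Adj v a))
    (hhB : ∀ v, v ∉ A → v ∉ B → (∀ a ∈ B, G.Adj v a) ∨ (∀ a ∈ B, ¬ G.Adj v a))
    (v a b : V) (ha : a ∈ A) (hb : b ∈ B) (hab : ¬ G.Adj a b) (hva : G.Adj v a) (hvb : G.Adj v b) :
    ∃ K₁ K₂ : Set V, (redGraph G A B P Q).IsClique K₁ ∧ (redGraph G A B P Q).IsClique K₂ ∧
    (redGraph G A B P Q).neighborSet v ⊆ K₁ ∪ K₂ := by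
  obtain ⟨K₁, K₂, h1, h2, h3⟩ := hG v
  have hne : a ≠ b := by rintro rfl; exact (Finset.disjoint_left.mp hd) ha hb
  rcases h3 (show a ∈ G.neighborSet v from hva) with k1 | k1 <;>
  rcases h3 (show b ∈ G.neighborSet v from hvb) with k2 | k2
  · exact absurd (h1 k1 k2 hne) hab
  · exact red_key G A B P Q hd hA hB hhA hhB v K₁ K₂ h1 h2 h3 a ha b hb k1 k2
  · exact red_key G A B P Q hd hA hB hhA hhB v K₂ K₁ h2 h1 (by rwa [Set.union_comm]) a ha b hb k1 k2
  · exact absurd (h2 k1 k2 hne) hab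

lemma red_noB {V : Type*} (G : SimpleGraph V) (hG : IsQuasiLine G) (A B P Q : Finset V)
    (v : V) (hv : ∀ x ∈ B, ¬ (redGraph G A B P Q).Adj v x) :
    ∃ K₁ K₂ : Set V, (redGraph G A B P Q).IsClique K₁ ∧ (redGraph G A B P Q).IsClique K₂ ∧
    (redGraph G A B P Q).neighborSet v ⊆ K₁ ∪ K₂ := by
  obtain ⟨K₁, K₂, h1, h2, h3⟩ := hG v
  refine ⟨{x | x ∈ K₁ ∧ x ∉ B}, {x | x ∈ K₂ ∧ x ∉ B}, ?_, ?_, ?_⟩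
  · intro x hx y hy hxy
    exact ⟨h1 hx.1 hy.1 hxy, fun _ h => absurd h hy.2, fun _ h => absurd h hx.2⟩
  · intro x hx y hy hxy
    exact ⟨h2 hx.1 hy.1 hxy, fun _ h => absurd h hy.2, fun _ h => absurd h hx.2⟩
  · intro x hx
    have h4 : x ∉ B := fun h => hv x h hx
    rcases h3 (show x ∈ G.neighborSet v from hx.1) with h | h
    · exact Or.inl ⟨h, h4⟩
    · exact Or.inr ⟨h, h4⟩

lemma red_qlA {V : Type*} (G : SimpleGraph V) (hG : IsQuasiLine G) (A B P Q : Finset V)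
    (hd : Disjoint A B) (hA : G.IsClique (A : Set V)) (hB : G.IsClique (B : Set V))
    (hhA : ∀ v, v ∉ A → v ∉ B → (∀ a ∈ A, G.Adj v a) ∨ (∀ a ∈ A, ¬ G.Adj v a))
    (hhB : ∀ v, v ∉ A → v ∉ B → (∀ a ∈ B, G.Adj v a) ∨ (∀ a ∈ B, ¬ G.Adj v a))
    (hmax : (∀ a ∈ A, ∀ q ∈ Q, G.Adj a q) → P = A) (hQ : Q ⊆ B)
    (hPQ : ∀ p ∈ P, ∀ q ∈ Q, G.Adj p q)
    (v : V) (hv : v ∈ A) :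
    ∃ K₁ K₂ : Set V, (redGraph G A B P Q).IsClique K₁ ∧ (redGraph G A B P Q).IsClique K₂ ∧
    (redGraph G A B P Q).neighborSet v ⊆ K₁ ∪ K₂ := by
  classical
  have hd' : ∀ x, x ∈ A → x ∉ B := fun x h h' => (Finset.disjoint_left.mp hd) h h'
  obtain ⟨K₁, K₂, h1, h2, h3⟩ := hG v
  by_cases hc : (∀ a ∈ A, ∀ q ∈ Q, G.Adj a q)
  · have hP := hmax hc
    refine ⟨{x | x ∈ K₁ ∧ (x ∈ B → x ∈ Q)}, {x | x ∈ K₂ ∧ (x ∈ B → x ∈ Q)}, ?_, ?_, ?_⟩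
    · intro x hx y hy hxy
      refine ⟨h1 hx.1 hy.1 hxy, ?_, ?_⟩
      · intro h h'; exact ⟨hP ▸ h, hy.2 h'⟩
      · intro h h'; exact ⟨hP ▸ h, hx.2 h'⟩
    · intro x hx y hy hxy
      refine ⟨h2 hx.1 hy.1 hxy, ?_, ?_⟩
      · intro h h'; exact ⟨hP ▸ h, hy.2 h'⟩
      · intro h h'; exact ⟨hP ▸ h, hx.2 h'⟩
    · intro x hx
      have := h3 (show x ∈ G.neighborSet v from hx.1)
      have h4 : x ∈ B → x ∈ Q := fun h => (hx.2.1 hv h).2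
      rcases this with h | h
      · exact Or.inl ⟨h, h4⟩
      · exact Or.inr ⟨h, h4⟩
  · push Not at hc
    obtain ⟨a, ha, b, hb, hab⟩ := hc
    by_cases hvP : v ∈ P
    · have hvb := hPQ v hvP b hb
      have hva : v ≠ a := by rintro rfl; exact hab hvb
      exact red_key2 G hG A B P Q hd hA hB hhA hhB v a b ha (hQ hb) hab (hA hv ha hva) hvb
    · exact red_noB G hG A B P Q v (fun x hx h => hvP (h.2.1 hv hx).1)

lemma red_ql {V : Type*} (G : SimpleGraph V) (hG : IsQuasiLine G) (A B P Q : Finset V)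
    (hd : Disjoint A B) (hA : G.IsClique (A : Set V)) (hB : G.IsClique (B : Set V))
    (hhA : ∀ v, v ∉ A → v ∉ B → (∀ a ∈ A, G.Adj v a) ∨ (∀ a ∈ A, ¬ G.Adj v a))
    (hhB : ∀ v, v ∉ A → v ∉ B → (∀ a ∈ B, G.Adj v a) ∨ (∀ a ∈ B, ¬ G.Adj v a))
    (hmaxA : (∀ a ∈ A, ∀ q ∈ Q, G.Adj a q) → P = A)
    (hmaxB : (∀ p ∈ P, ∀ b ∈ B, G.Adj p b) → Q = B)
    (hP : P ⊆ A) (hQ : Q ⊆ B) (hPQ : ∀ p ∈ P, ∀ q ∈ Q, G.Adj p q)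
    (hne : ∃ a ∈ A, ∃ b ∈ B, ¬ G.Adj a b) :
    IsQuasiLine (redGraph G A B P Q) := by
  intro v
  by_cases hvA : v ∈ A
  · exact red_qlA G hG A B P Q hd hA hB hhA hhB hmaxA hQ hPQ v hvA
  by_cases hvB : v ∈ B
  · rw [redGraph_swap]
    exact red_qlA G hG B A Q P hd.symm hB hA (fun v h h' => hhB v h' h) (fun v h h' => hhA v h' h)
      (fun h => hmaxB fun p hp b hb => (h b hb p hp).symm) hP
      (fun q hq p hp => (hPQ p hp q hq).symm) v hvB
  rcases hhA v hvA hvB with h | h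
  · rcases hhB v hvA hvB with h' | h'
    · obtain ⟨a, ha, b, hb, hab⟩ := hne
      exact red_key2 G hG A B P Q hd hA hB hhA hhB v a b ha hb hab (h a ha) (h' b hb)
    · exact red_noB G hG A B P Q v (fun x hx k => h' x hx k.1)
  · rw [redGraph_swap]
    exact red_noB G hG B A Q P v (fun x hx k => h x hx k.1)

lemma exists_match {V : Type*} [DecidableEq V] (A B : Finset V)
    (R : V → V → Prop) [DecidableRel R] (n d : ℕ) (hnd : n + d = A.card)
    (hall : ∀ X ⊆ A, X.card ≤ (B.filter (fun b => ∃ a ∈ X, R a b)).card + d) :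
    ∃ A0 ⊆ A, ∃ p : V → V, A0.card = n ∧ Set.InjOn p A0 ∧ ∀ a ∈ A0, p a ∈ B ∧ R a (p a) := by
  obtain ⟨m, hm, hmR⟩ := (Finset.all_card_le_biUnion_card_iff_exists_injective
    (fun a : A => (B.filter (fun b => R a b)).disjSum (Finset.univ : Finset (Fin d)))).1 (by
      intro s
      rcases s.eq_empty_or_nonempty with rfl | ⟨a0, ha0⟩
      · simp
      have h1 := hall (s.map (Function.Embedding.subtype _)) (by
        intro x hx
        obtain ⟨y, _, rfl⟩ := Finset.mem_map.1 hx
        exact y.2)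
      rw [Finset.card_map] at h1
      have h2 : (B.filter (fun b => ∃ a ∈ s.map (Function.Embedding.subtype _), R a b)).disjSum
          (Finset.univ : Finset (Fin d)) ⊆
          s.biUnion (fun a : A => (B.filter (fun b => R a b)).disjSum Finset.univ) := by
        intro x hx
        rw [Finset.mem_biUnion]
        rcases x with x | x
        · rw [Finset.inl_mem_disjSum, Finset.mem_filter] at hx
          obtain ⟨hxB, a, ha, hR⟩ := hx
          obtain ⟨y, hy, rfl⟩ := Finset.mem_map.1 ha
          exact ⟨y, hy, Finset.inl_mem_disjSum.2 (Finset.mem_filter.2 ⟨hxB, hR⟩)⟩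
        · exact ⟨a0, ha0, Finset.inr_mem_disjSum.2 (Finset.mem_univ _)⟩
      have h3 := Finset.card_le_card h2
      rw [Finset.card_disjSum, Finset.card_univ, Fintype.card_fin] at h3
      omega)
  let A1 : Finset V := A.filter (fun a => ∃ h : a ∈ A, (m ⟨a, h⟩).isLeft = true)
  have hA1c : n ≤ A1.card := by
    have h1 : (A \ A1).card ≤ d := by
      have hx : ∀ a ∈ A \ A1, ∃ i : ℕ, ∃ h : a ∈ A, ∃ hi : i < d, m ⟨a, h⟩ = Sum.inr ⟨i, hi⟩ := by
        intro a ha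
        rw [Finset.mem_sdiff] at ha
        cases h : m ⟨a, ha.1⟩ with
        | inl y => exact absurd (Finset.mem_filter.2 ⟨ha.1, ha.1, by rw [h]; rfl⟩) ha.2
        | inr y => exact ⟨y.1, ha.1, y.2, h⟩
      choose! φ hφ using hx
      have := Finset.card_le_card_of_injOn (s := A \ A1) (t := Finset.range d) φ
        (fun a ha => by obtain ⟨_, hi, _⟩ := hφ a ha; simpa using hi) (by
          intro a ha b hb hab
          obtain ⟨h1, i1, h2⟩ := hφ a ha
          obtain ⟨h3, i3, h4⟩ := hφ b hb
          have := hm (h2.trans ((congrArg Sum.inr (Fin.ext hab)).trans h4.symm))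
          exact congrArg Subtype.val this)
      simpa using this
    have hsub : A1 ⊆ A := Finset.filter_subset _ _
    have := Finset.card_sdiff_add_card_eq_card hsub
    omega
  obtain ⟨A0, hA01, hA0c⟩ := Finset.exists_subset_card_eq hA1c
  have hx : ∀ a ∈ A0, ∃ b : V, ∃ h : a ∈ A, m ⟨a, h⟩ = Sum.inl b := by
    intro a ha
    obtain ⟨_, h, h'⟩ := Finset.mem_filter.1 (hA01 ha)
    cases h2 : m ⟨a, h⟩ with
    | inl y => exact ⟨y, h, h2⟩
    | inr y => rw [h2] at h'; cases h'
  choose! p hp using hx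
  refine ⟨A0, hA01.trans (Finset.filter_subset _ _), p, hA0c, ?_, ?_⟩
  · intro a ha b hb hab
    obtain ⟨h1, h2⟩ := hp a ha
    obtain ⟨h3, h4⟩ := hp b hb
    exact congrArg Subtype.val (hm (h2.trans ((congrArg Sum.inl hab).trans h4.symm)))
  · intro a ha
    obtain ⟨h1, h2⟩ := hp a ha
    have := hmR ⟨a, h1⟩
    rw [h2, Finset.inl_mem_disjSum, Finset.mem_filter] at this
    exact this

lemma extend_bij {V K : Type*} [DecidableEq V] [DecidableEq K] (A A0 : Finset V) (T : Finset K)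
    (hA0 : A0 ⊆ A) (hc : A.card = T.card) (φ : V → K) (hφ : ∀ a ∈ A0, φ a ∈ T)
    (hi : Set.InjOn φ A0) :
    ∃ f : V → K, (∀ a ∈ A, f a ∈ T) ∧ Set.InjOn f A ∧ ∀ a ∈ A0, f a = φ a := by
  obtain ⟨g, hg⟩ := Set.MapsTo.exists_equiv_extend_of_card_eq (α := A) (t := T)
    (by rwa [Fintype.card_coe]) (s := {a : A | a.1 ∈ A0}) (f := fun a => φ a.1)
    (fun a ha => hφ a.1 ha) (fun a ha b hb hab => Subtype.ext (hi ha hb hab))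
  refine ⟨fun v => if h : v ∈ A then g ⟨v, h⟩ else φ v, ?_, ?_, ?_⟩
  · intro a ha
    simp only [ha, dif_pos]
    exact (g _).2
  · intro a ha b hb hab
    have ha' : a ∈ A := ha
    have hb' : b ∈ A := hb
    simp only [ha', hb', dif_pos] at hab
    exact congrArg Subtype.val (g.injective (Subtype.ext hab))
  · intro a ha
    simp only [hA0 ha, dif_pos]
    exact hg ⟨a, hA0 ha⟩ ha

lemma recolor {V K : Type*} [DecidableEq V] [DecidableEq K] (A B : Finset V)
    (R : V → V → Prop) [DecidableRel R]
    (c : V → K) (cA : Set.InjOn c A) (cB : Set.InjOn c B)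
    (hall : ∀ X ⊆ A, X.card + (A.image c ∩ B.image c).card ≤
      (B.filter (fun b => ∃ a ∈ X, R a b)).card + A.card) :
    ∃ f g : V → K, (∀ a ∈ A, f a ∈ A.image c) ∧ (∀ b ∈ B, g b ∈ B.image c) ∧
      Set.InjOn f A ∧ Set.InjOn g B ∧ ∀ a ∈ A, ∀ b ∈ B, f a = g b → R a b := by
  have hSA : (A.image c ∩ B.image c).card ≤ A.card :=
    (Finset.card_le_card Finset.inter_subset_left).trans Finset.card_image_le
  obtain ⟨A0, hA0, p, hA0c, hpi, hp⟩ := exists_match A B R (A.image c ∩ B.image c).card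
    (A.card - (A.image c ∩ B.image c).card) (by omega) (by
      intro X hX
      have := hall X hX
      omega)
  have e : A0 ≃ (A.image c ∩ B.image c : Finset K) := Finset.equivOfCardEq hA0c
  have hφ : ∃ φ : V → K, (∀ a ∈ A0, φ a ∈ A.image c ∩ B.image c) ∧ Set.InjOn φ A0 ∧
      ∀ x ∈ A.image c ∩ B.image c, ∃ a ∈ A0, φ a = x := by
    refine ⟨fun v => if h : v ∈ A0 then e ⟨v, h⟩ else c v, ?_, ?_, ?_⟩
    · intro a ha
      simp only [ha, dif_pos]
      exact (e _).2
    · intro a ha b hb hab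
      have ha' : a ∈ A0 := ha
      have hb' : b ∈ A0 := hb
      simp only [ha', hb', dif_pos] at hab
      exact congrArg Subtype.val (e.injective (Subtype.ext hab))
    · intro x hx
      refine ⟨(e.symm ⟨x, hx⟩).1, (e.symm ⟨x, hx⟩).2, ?_⟩
      simp
  obtain ⟨φ, hφS, hφi, hφs⟩ := hφ
  obtain ⟨f, hf, hfi, hfe⟩ := extend_bij A A0 (A.image c) hA0
    (Finset.card_image_of_injOn cA).symm φ (fun a ha => (Finset.mem_inter.1 (hφS a ha)).1) hφi
  -- colour partners
  have hψ : ∃ ψ : V → K, ∀ a ∈ A0, ψ (p a) = φ a := by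
    refine ⟨fun b => if h : ∃ a ∈ A0, p a = b then φ h.choose else c b, ?_⟩
    intro a ha
    have h : ∃ a' ∈ A0, p a' = p a := ⟨a, ha, rfl⟩
    simp only [h, dif_pos]
    exact congrArg φ (hpi h.choose_spec.1 ha h.choose_spec.2)
  obtain ⟨ψ, hψ⟩ := hψ
  obtain ⟨g, hg, hgi, hge⟩ := extend_bij B (A0.image p) (B.image c)
    (by
      intro b hb
      obtain ⟨a, ha, rfl⟩ := Finset.mem_image.1 hb
      exact (hp a ha).1)
    (Finset.card_image_of_injOn cB).symm ψ
    (by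
      intro b hb
      obtain ⟨a, ha, rfl⟩ := Finset.mem_image.1 hb
      rw [hψ a ha]
      exact (Finset.mem_inter.1 (hφS a ha)).2)
    (by
      intro b hb b' hb' hbb
      obtain ⟨a, ha, rfl⟩ := Finset.mem_image.1 hb
      obtain ⟨a', ha', rfl⟩ := Finset.mem_image.1 hb'
      rw [hψ a ha, hψ a' ha'] at hbb
      rw [hφi ha ha' hbb])
  refine ⟨f, g, hf, hg, hfi, hgi, ?_⟩
  intro a ha b hb hab
  obtain ⟨a', ha', hx⟩ := hφs (f a) (Finset.mem_inter.2 ⟨hf a ha, hab ▸ hg b hb⟩)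
  have h1 : a' = a := hfi (hA0 ha') ha ((hfe a' ha').trans hx)
  subst h1
  have h2 : p a' = b := by
    apply hgi (hp a' ha').1 hb
    rw [hge _ (Finset.mem_image_of_mem p ha'), hψ a' ha', hx, hab]
  rw [← h2]
  exact (hp a' ha').2

lemma red_colorable {V : Type*} (G : SimpleGraph V) (A B P Q : Finset V)
    (hd : Disjoint A B) (hA : G.IsClique (A : Set V)) (hB : G.IsClique (B : Set V))
    (hhA : ∀ v, v ∉ A → v ∉ B → (∀ a ∈ A, G.Adj v a) ∨ (∀ a ∈ A, ¬ G.Adj v a))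
    (hhB : ∀ v, v ∉ A → v ∉ B → (∀ a ∈ B, G.Adj v a) ∨ (∀ a ∈ B, ¬ G.Adj v a))
    (hP : P ⊆ A) (hQ : Q ⊆ B) (hPQ : ∀ p ∈ P, ∀ q ∈ Q, G.Adj p q)
    (hmax : ∀ X ⊆ A, ∀ Y ⊆ B, (∀ x ∈ X, ∀ y ∈ Y, G.Adj x y) → X.card + Y.card ≤ P.card + Q.card)
    (n : ℕ) (hc : (redGraph G A B P Q).Colorable n) : G.Colorable n := by
  classical
  obtain ⟨c⟩ := hc
  have hd' : ∀ x, x ∈ A → x ∉ B := fun x h h' => (Finset.disjoint_left.mp hd) h h'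
  have cA : Set.InjOn c A := by
    intro a ha b hb hab
    by_contra hne
    exact c.valid (show (redGraph G A B P Q).Adj a b from ⟨hA ha hb hne,
      fun _ h => absurd h (hd' b hb), fun _ h => absurd h (hd' a ha)⟩) hab
  have cB : Set.InjOn c B := by
    intro a ha b hb hab
    by_contra hne
    exact c.valid (show (redGraph G A B P Q).Adj a b from ⟨hB ha hb hne,
      fun h _ => absurd ha (hd' a h), fun h _ => absurd hb (hd' b h)⟩) hab
  have hS : P.card + Q.card + (A.image c ∩ B.image c).card ≤ A.card + B.card := by
    have h1 := Finset.card_union_add_card_inter (A.image c) (B.image c)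
    rw [Finset.card_image_of_injOn cA, Finset.card_image_of_injOn cB] at h1
    have h2 : Disjoint (P.image c) (Q.image c) := by
      rw [Finset.disjoint_left]
      intro x hx hy
      obtain ⟨p, hp, rfl⟩ := Finset.mem_image.1 hx
      obtain ⟨q, hq, hpq⟩ := Finset.mem_image.1 hy
      exact c.valid (show (redGraph G A B P Q).Adj p q from ⟨hPQ p hp q hq,
        fun _ _ => ⟨hp, hq⟩, fun h => absurd (hQ hq) (hd' q h)⟩) hpq.symm
    have h3 := Finset.card_le_card (Finset.union_subset_union
      (Finset.image_subset_image (f := c) hP) (Finset.image_subset_image (f := c) hQ))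
    rw [Finset.card_union_of_disjoint h2,
      Finset.card_image_of_injOn (cA.mono (Finset.coe_subset.2 hP)),
      Finset.card_image_of_injOn (cB.mono (Finset.coe_subset.2 hQ))] at h3
    omega
  obtain ⟨f, g, hf, hg, hfi, hgi, hfg⟩ := recolor A B (fun a b => ¬ G.Adj a b) c cA cB (by
    intro X hX
    have h1 := hmax X hX (B.filter (fun b => ¬ ∃ a ∈ X, ¬ G.Adj a b)) (Finset.filter_subset _ _) (by
      intro x hx y hy
      by_contra h
      exact (Finset.mem_filter.1 hy).2 ⟨x, hx, h⟩)
    have h2 := Finset.card_filter_add_card_filter_not (s := B) (fun b => ∃ a ∈ X, ¬ G.Adj a b)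
    omega)
  have out : ∀ v a, v ∉ A → v ∉ B → a ∈ A → G.Adj v a → c v ≠ f a := by
    intro v a hvA hvB ha hva hcf
    obtain ⟨a', ha', h⟩ := Finset.mem_image.1 (hf a ha)
    rcases hhA v hvA hvB with h1 | h1
    · exact c.valid (show (redGraph G A B P Q).Adj v a' from ⟨h1 a' ha',
        fun h => absurd h hvA, fun _ h => absurd h hvB⟩) (hcf.trans h.symm)
    · exact h1 a ha hva
  have out' : ∀ v a, v ∉ A → v ∉ B → a ∈ B → G.Adj v a → c v ≠ g a := by
    intro v a hvA hvB ha hva hcf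
    obtain ⟨a', ha', h⟩ := Finset.mem_image.1 (hg a ha)
    rcases hhB v hvA hvB with h1 | h1
    · exact c.valid (show (redGraph G A B P Q).Adj v a' from ⟨h1 a' ha',
        fun h => absurd h hvA, fun _ h => absurd h hvB⟩) (hcf.trans h.symm)
    · exact h1 a ha hva
  refine ⟨SimpleGraph.Coloring.mk (fun v => if v ∈ A then f v else if v ∈ B then g v else c v) ?_⟩
  intro u v huv
  by_cases huA : u ∈ A
  · by_cases hvA : v ∈ A
    · simp only [huA, hvA, if_true]
      exact fun h => huv.ne (hfi huA hvA h)
    by_cases hvB : v ∈ B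
    · simp only [huA, hvA, hvB, if_true, if_false]
      exact fun h => hfg u huA v hvB h huv
    · simp only [huA, hvA, hvB, if_true, if_false]
      exact (out v u hvA hvB huA huv.symm).symm
  by_cases huB : u ∈ B
  · by_cases hvA : v ∈ A
    · simp only [huA, huB, hvA, if_true, if_false]
      exact fun h => hfg v hvA u huB h.symm huv.symm
    by_cases hvB : v ∈ B
    · simp only [huA, huB, hvA, hvB, if_true, if_false]
      exact fun h => huv.ne (hgi huB hvB h)
    · simp only [huA, huB, hvA, hvB, if_true, if_false]
      exact (out' v u hvA hvB huB huv.symm).symm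
  · by_cases hvA : v ∈ A
    · simp only [huA, huB, hvA, if_true, if_false]
      exact out u v huA huB hvA huv
    by_cases hvB : v ∈ B
    · simp only [huA, huB, hvA, hvB, if_true, if_false]
      exact out' u v huA huB hvB huv
    · simp only [huA, huB, hvA, hvB, if_false]
      exact c.valid (show (redGraph G A B P Q).Adj u v from ⟨huv,
        fun h => absurd h huA, fun h => absurd h hvA⟩)

/-- If a finite quasi-line graph `G` contains a nonlinear homogeneous pair of cliques,
then there is a quasi-line graph `G'` on the same vertex set whose edge set is a
proper subset of that of `G` and with `χ(G') = χ(G)`. -/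
theorem quasiLine_reduce_nonlinear_pair {V : Type*} [Fintype V]
    (G : SimpleGraph V) (hG : IsQuasiLine G)
    (A B : Set V) (hAB : IsNonlinearHomogeneousPairOfCliques G A B) :
    ∃ G' : SimpleGraph V, IsQuasiLine G' ∧ G'.edgeSet ⊂ G.edgeSet ∧
      G'.chromaticNumber = G.chromaticNumber := by
  classical
  obtain ⟨⟨hd, -, -, hA, hB, -, hh⟩, v₁, v₂, v₃, v₄, m1, m2, m3, m4, n12, n13, n14, n23, n24, n34,
    a12, a23, a34, a41, na13, na24⟩ := hAB
  obtain ⟨A, rfl⟩ := A.toFinite.exists_finset_coe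
  obtain ⟨B, rfl⟩ := B.toFinite.exists_finset_coe
  rw [Finset.disjoint_coe] at hd
  have hhA : ∀ v, v ∉ A → v ∉ B → (∀ a ∈ A, G.Adj v a) ∨ (∀ a ∈ A, ¬ G.Adj v a) := by
    intro v h h'
    exact (hh v (by simp [h, h'])).1
  have hhB : ∀ v, v ∉ A → v ∉ B → (∀ a ∈ B, G.Adj v a) ∨ (∀ a ∈ B, ¬ G.Adj v a) := by
    intro v h h'
    exact (hh v (by simp [h, h'])).2
  have hC4 : ∃ a₁ ∈ A, ∃ a₂ ∈ A, ∃ b₁ ∈ B, ∃ b₂ ∈ B, G.Adj a₁ b₁ ∧ G.Adj a₂ b₂ ∧ ¬ G.Adj a₁ b₂ := by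
    have k1 : ∀ x y, x ∈ (A : Set V) ∪ B → y ∈ (A : Set V) ∪ B → x ≠ y → ¬ G.Adj x y →
        (x ∈ A ∧ y ∈ B) ∨ (x ∈ B ∧ y ∈ A) := by
      intro x y hx hy hxy hn
      rcases hx with hx | hx <;> rcases hy with hy | hy
      · exact absurd (hA hx hy hxy) hn
      · exact Or.inl ⟨hx, hy⟩
      · exact Or.inr ⟨hx, hy⟩
      · exact absurd (hB hx hy hxy) hn
    rcases k1 v₁ v₃ m1 m3 n13 na13 with ⟨h1, h3⟩ | ⟨h1, h3⟩ <;>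
    rcases k1 v₂ v₄ m2 m4 n24 na24 with ⟨h2, h4⟩ | ⟨h2, h4⟩
    · exact ⟨v₁, h1, v₂, h2, v₄, h4, v₃, h3, a41.symm, a23, na13⟩
    · exact ⟨v₁, h1, v₄, h4, v₂, h2, v₃, h3, a12, a34.symm, na13⟩
    · exact ⟨v₃, h3, v₂, h2, v₄, h4, v₁, h1, a34, a12.symm, fun h => na13 h.symm⟩
    · exact ⟨v₃, h3, v₄, h4, v₂, h2, v₁, h1, a23.symm, a41, fun h => na13 h.symm⟩
  obtain ⟨a₁, ha₁, a₂, ha₂, b₁, hb₁, b₂, hb₂, e11, e22, n12'⟩ := hC4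
  obtain ⟨⟨P, Q⟩, hPQm, hmax⟩ := Finset.exists_max_image
    ((A.powerset ×ˢ B.powerset).filter (fun z => ∀ x ∈ z.1, ∀ y ∈ z.2, G.Adj x y))
    (fun z => z.1.card + z.2.card) ⟨(∅, ∅), by simp⟩
  simp only [Finset.mem_filter, Finset.mem_product, Finset.mem_powerset] at hPQm hmax
  obtain ⟨⟨hP, hQ⟩, hPQ⟩ := hPQm
  have hmax' : ∀ X ⊆ A, ∀ Y ⊆ B, (∀ x ∈ X, ∀ y ∈ Y, G.Adj x y) →
      X.card + Y.card ≤ P.card + Q.card := fun X hX Y hY h => hmax (X, Y) ⟨⟨hX, hY⟩, h⟩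
  have hle : redGraph G A B P Q ≤ G := fun u v h => h.1
  refine ⟨redGraph G A B P Q, ?_, ?_, ?_⟩
  · refine red_ql G hG A B P Q hd hA hB hhA hhB ?_ ?_ hP hQ hPQ ⟨a₁, ha₁, b₂, hb₂, n12'⟩
    · intro h
      have := hmax' A subset_rfl Q hQ h
      exact Finset.eq_of_subset_of_card_le hP (by omega)
    · intro h
      have := hmax' P hP B subset_rfl h
      exact Finset.eq_of_subset_of_card_le hQ (by omega)
  · rw [SimpleGraph.edgeSet_ssubset_edgeSet]
    refine lt_of_le_of_ne hle ?_
    intro heq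
    have h1 : (redGraph G A B P Q).Adj a₁ b₁ := by rw [heq]; exact e11
    have h2 : (redGraph G A B P Q).Adj a₂ b₂ := by rw [heq]; exact e22
    exact n12' (hPQ _ (h1.2.1 ha₁ hb₁).1 _ (h2.2.1 ha₂ hb₂).2)
  · apply le_antisymm
    · exact SimpleGraph.chromaticNumber_mono _ hle
    · exact SimpleGraph.chromaticNumber_le_of_forall_imp
        (red_colorable G A B P Q hd hA hB hhA hhB hP hQ hPQ hmax')
end
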